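/- Let λ ∈ (4/3, 3/2). There exists a constant c > 0, independent of n, such that for all n ≥ 1 the function g_n(x) = φ(x)² cos(λ2^n x) satisfies ‖Λ g_n‖_{L²(ℝ)} ≥ c 2^n ‖g_n‖_{L²(ℝ)}; more precisely, ∫_ℝ (1+ξ²) |ĝ_n(ξ)|² dξ ≥ (λ2^n − 1)² ∫_ℝ |ĝ_n(ξ)|² dξ. -/

import Mathlib

open MeasureTheory Filter Complex

noncomputable section

/-- Fourier transform with convention `f̂(ξ) = ∫ e^{-ixξ} f(x) dx`. -/
def FT (f : ℝ → ℂ) (ξ : ℝ) : ℂ :=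
  ∫ x : ℝ, Complex.exp (-(Complex.I * (x : ℂ) * (ξ : ℂ))) * f x

/-- Sobolev `H^σ` norm: `‖f‖_{H^σ}² = ∫ (1+ξ²)^σ |f̂(ξ)|² dξ`. -/
def HNorm (σ : ℝ) (f : ℝ → ℂ) : ℝ :=
  Real.sqrt (∫ ξ : ℝ, (1 + ξ ^ 2) ^ σ * ‖FT f ξ‖ ^ 2)

/-- Membership in `H^σ` (finiteness of the `H^σ` norm). -/
def MemHs (σ : ℝ) (f : ℝ → ℂ) : Prop :=
  MeasureTheory.Integrable (fun ξ : ℝ => (1 + ξ ^ 2) ^ σ * ‖FT f ξ‖ ^ 2)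

/-- `L²` norm. -/
def L2Norm (f : ℝ → ℂ) : ℝ :=
  Real.sqrt (∫ x : ℝ, ‖f x‖ ^ 2)

/-- Fourier multiplier operator with symbol `m`. -/
def FMul (m : ℝ → ℂ) (f : ℝ → ℂ) (x : ℝ) : ℂ :=
  (1 / (2 * (Real.pi : ℂ))) * ∫ ξ : ℝ, Complex.exp (Complex.I * (x : ℂ) * (ξ : ℂ)) * m ξ * FT f ξ

/-- `Λ = (1-∂ₓ²)^{1/2}`: Fourier multiplier with symbol `(1+ξ²)^{1/2}`. -/
def Lam (f : ℝ → ℂ) : ℝ → ℂ :=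
  FMul (fun ξ => ((Real.sqrt (1 + ξ ^ 2) : ℝ) : ℂ)) f

/-- `e^{-t ∂ₓ Λ^{-1}}`: Fourier multiplier with symbol `e^{-itξ(1+ξ²)^{-1/2}}`. -/
def ExpOp (t : ℝ) (f : ℝ → ℂ) : ℝ → ℂ :=
  FMul (fun ξ => Complex.exp (-(Complex.I * (t : ℂ) * (ξ : ℂ) / ((Real.sqrt (1 + ξ ^ 2) : ℝ) : ℂ)))) f

/-- Hypotheses on the fixed Schwartz function `φ`: its Fourier transform is a smooth, even,
real-valued function with values in `[0,1]`, equal to `1` on `[-1/4,1/4]` and to `0`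
outside `(-1/2,1/2)`. -/
def PhiHyp (φ : ℝ → ℂ) : Prop :=
  ∃ ψ : ℝ → ℝ, (∀ ξ : ℝ, FT φ ξ = (ψ ξ : ℂ)) ∧ ContDiff ℝ (⊤ : ℕ∞) ψ ∧
    (∀ ξ : ℝ, ψ (-ξ) = ψ ξ) ∧ (∀ ξ : ℝ, ψ ξ ∈ Set.Icc (0 : ℝ) 1) ∧
    (∀ ξ : ℝ, |ξ| ≤ 1 / 4 → ψ ξ = 1) ∧ (∀ ξ : ℝ, 1 / 2 ≤ |ξ| → ψ ξ = 0)

/-- The high-frequency data `u_{0,n}(x) = 2^{-ns} φ(x) sin(λ 2ⁿ x)`. -/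
def u0n (s lam : ℝ) (φ : ℝ → ℂ) (n : ℕ) : ℝ → ℂ :=
  fun x => (((2 : ℝ) ^ (-((n : ℝ) * s)) : ℝ) : ℂ) * φ x * ((Real.sin (lam * 2 ^ n * x) : ℝ) : ℂ)

/-- The low-frequency data `f_n(x) = 2^{-n} φ(x)`. -/
def fseq (φ : ℝ → ℂ) (n : ℕ) : ℝ → ℂ :=
  fun x => (((2 : ℝ) ^ (-(n : ℝ)) : ℝ) : ℂ) * φ x

/-- The kernel `K(x) = -(1/2) sgn(x) e^{-|x|}`, so that `K*f = ∂ₓ(1-∂ₓ²)^{-1} f`. -/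
def Kker (x : ℝ) : ℝ := -(1 / 2) * Real.sign x * Real.exp (-|x|)

/-- Convolution with the kernel `K`. -/
def Kconv (f : ℝ → ℂ) (x : ℝ) : ℂ := ∫ y : ℝ, ((Kker (x - y) : ℝ) : ℂ) * f y

/-- `(u,ϱ)` solves the two-component Camassa–Holm system (in nonlocal form) on `[0,T]`. -/
def Is2CHSolution (T : ℝ) (u ϱ : ℝ → ℝ → ℂ) : Prop :=
  ∀ t ∈ Set.Icc (0 : ℝ) T, ∀ x : ℝ,
    (deriv (fun τ => u τ x) t + Kconv (ϱ t) x + u t x * deriv (u t) x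
      = - Kconv (fun y => (u t y) ^ 2 + (1 / 2 : ℂ) * (deriv (u t) y) ^ 2
          + (1 / 2 : ℂ) * (ϱ t y) ^ 2) x)
    ∧ (deriv (fun τ => ϱ τ x) t + deriv (u t) x + u t x * deriv (ϱ t) x
        + ϱ t x * deriv (u t) x = 0)

/-- `u ∈ C([0,T]; H^γ)`: each time slice is in `H^γ` and `t ↦ u(t)` is continuous
in the `H^γ` norm. -/
def ContInHs (T γ : ℝ) (u : ℝ → ℝ → ℂ) : Prop :=
  (∀ t ∈ Set.Icc (0 : ℝ) T, MemHs γ (u t)) ∧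
  ∀ t₀ ∈ Set.Icc (0 : ℝ) T,
    Filter.Tendsto (fun t => HNorm γ (fun x => u t x - u t₀ x))
      (nhdsWithin t₀ (Set.Icc (0 : ℝ) T)) (nhds 0)

end

noncomputable section

open scoped FourierTransform SchwartzMap

theorem iteratedDeriv_cexp_I_mul (b : ℝ) (n : ℕ) :
    iteratedDeriv n (fun x : ℝ => exp (I * b * x)) =
      fun x : ℝ => (I * b) ^ n * exp (I * b * x) := by
  induction n with
  | zero => simp
  | succ n ih =>
    rw [iteratedDeriv_succ, ih]
    funext x
    have h : HasDerivAt (fun x : ℝ => I * b * (x : ℂ)) (I * b) x := by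
      simpa using (Complex.ofRealCLM.hasDerivAt (x := x)).const_mul (I * b)
    rw [(h.cexp.const_mul _).deriv]
    ring

theorem norm_cexp_I_mul (b x : ℝ) : ‖exp (I * b * x)‖ = 1 := by
  rw [show I * (b : ℂ) * x = ((b * x : ℝ) : ℂ) * I by push_cast; ring,
    norm_exp_ofReal_mul_I]

theorem hasTemperateGrowth_cexp_I_mul (b : ℝ) :
    (fun x : ℝ => exp (I * b * x)).HasTemperateGrowth := by
  refine ⟨?_, fun n => ⟨0, |b| ^ n, fun x => ?_⟩⟩
  · exact (contDiff_const.mul Complex.ofRealCLM.contDiff).cexp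
  · rw [norm_iteratedFDeriv_eq_norm_iteratedDeriv, iteratedDeriv_cexp_I_mul, norm_mul,
      norm_cexp_I_mul]
    simp

/-- The modulation `x ↦ e^{ibx} f(x)` of a Schwartz function. -/
def modulate (b : ℝ) (f : 𝓢(ℝ, ℂ)) : 𝓢(ℝ, ℂ) :=
  SchwartzMap.smulLeftCLM ℂ (fun x : ℝ => exp (I * b * x)) f

theorem modulate_apply (b : ℝ) (f : 𝓢(ℝ, ℂ)) (x : ℝ) :
    modulate b f x = exp (I * b * x) * f x := by
  simp [modulate, SchwartzMap.smulLeftCLM_apply_apply (hasTemperateGrowth_cexp_I_mul b)]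

theorem FT_eq_fourier (f : ℝ → ℂ) (ξ : ℝ) : FT f ξ = 𝓕 f (ξ / (2 * Real.pi)) := by
  rw [Real.fourier_real_eq_integral_exp_smul, FT]
  congr 1
  funext x
  rw [smul_eq_mul]
  congr 2
  push_cast
  have : (Real.pi : ℂ) ≠ 0 := by exact_mod_cast Real.pi_ne_zero
  field_simp

theorem fourier_eq_FT (f : 𝓢(ℝ, ℂ)) (w : ℝ) : 𝓕 f w = FT f (2 * Real.pi * w) := by
  rw [FT_eq_fourier, SchwartzMap.fourier_coe, mul_div_cancel_left₀ _ Real.two_pi_pos.ne']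

theorem FT_modulate (b : ℝ) (f : 𝓢(ℝ, ℂ)) (ξ : ℝ) : FT (modulate b f) ξ = FT f (ξ - b) := by
  simp only [FT, modulate_apply]
  congr 1
  funext x
  rw [← mul_assoc, ← exp_add]
  congr 2
  push_cast
  ring

theorem integrable_cexp_mul (f : 𝓢(ℝ, ℂ)) (ξ : ℝ) :
    Integrable (fun x : ℝ => exp (-(I * x * ξ)) * f x) := by
  refine (modulate (-ξ) f).integrable.congr (Eventually.of_forall fun x => ?_)
  simp only [modulate_apply]
  congr 2
  push_cast
  ring

theorem FT_mul_eq_zero {φ : 𝓢(ℝ, ℂ)} {r : ℝ} (hφ : ∀ ξ, r ≤ |ξ| → FT φ ξ = 0)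
    {ξ : ℝ} (hξ : 2 * r ≤ |ξ|) : FT (fun x => φ x * φ x) ξ = 0 := by
  have h := SchwartzMap.integral_fourier_mul_eq (𝓕⁻ φ) (modulate (-ξ) φ)
  rw [FourierTransform.fourier_fourierInv_eq] at h
  have h0 : ∀ y : ℝ, (𝓕⁻ φ) y * (𝓕 (modulate (-ξ) φ)) y = 0 := by
    intro y
    have e : (𝓕⁻ φ) y = FT φ (2 * Real.pi * -y) := by
      rw [← fourier_eq_FT, SchwartzMap.fourierInv_coe, SchwartzMap.fourier_coe,
        Real.fourierInv_eq_fourier_neg]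
    rw [e, fourier_eq_FT, FT_modulate]
    rcases le_total r |2 * Real.pi * -y| with hy | hy
    · rw [hφ _ hy, zero_mul]
    · rw [hφ (2 * Real.pi * y - -ξ), mul_zero]
      rw [mul_neg, abs_neg] at hy
      have := abs_sub_abs_le_abs_sub ξ (-(2 * Real.pi * y))
      rw [abs_neg] at this
      rw [show 2 * Real.pi * y - -ξ = ξ - -(2 * Real.pi * y) by ring]
      linarith
  rw [integral_congr_ae (Eventually.of_forall h0), integral_zero] at h
  rw [FT, ← h]
  congr 1
  funext x
  rw [modulate_apply, mul_left_comm]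
  congr 3
  push_cast
  ring

/-- The Schwartz function `x ↦ φ(x)² cos(ax)`. -/
def sqCos (φ : 𝓢(ℝ, ℂ)) (a : ℝ) : 𝓢(ℝ, ℂ) :=
  SchwartzMap.smulLeftCLM ℂ (φ : ℝ → ℂ) ((1 / 2 : ℂ) • (modulate a φ + modulate (-a) φ))

theorem sqCos_apply (φ : 𝓢(ℝ, ℂ)) (a x : ℝ) :
    sqCos φ a x = (φ x) ^ 2 * ((Real.cos (a * x) : ℝ) : ℂ) := by
  simp only [sqCos, SchwartzMap.smulLeftCLM_apply_apply φ.hasTemperateGrowth,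
    smul_apply, add_apply, modulate_apply, smul_eq_mul]
  rw [ofReal_cos, Complex.cos, show I * (a : ℂ) * x = ((a * x : ℝ) : ℂ) * I by push_cast; ring,
    show I * ((-a : ℝ) : ℂ) * x = -((a * x : ℝ) : ℂ) * I by push_cast; ring]
  ring

theorem FT_sqCos (φ : 𝓢(ℝ, ℂ)) (a ξ : ℝ) :
    FT (sqCos φ a) ξ =
      (FT (fun x => φ x * φ x) (ξ - a) + FT (fun x => φ x * φ x) (ξ + a)) / 2 := by
  have hφ : ∀ x, SchwartzMap.smulLeftCLM ℂ (φ : ℝ → ℂ) φ x = φ x * φ x := fun x => by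
    rw [SchwartzMap.smulLeftCLM_apply_apply φ.hasTemperateGrowth, smul_eq_mul]
  have h := fun η => integrable_cexp_mul (SchwartzMap.smulLeftCLM ℂ (φ : ℝ → ℂ) φ) η
  simp only [hφ] at h
  rw [FT, FT, FT, ← integral_add (h _) (h _), ← integral_div]
  congr 1
  funext x
  simp only [sqCos, SchwartzMap.smulLeftCLM_apply_apply φ.hasTemperateGrowth,
    smul_apply, add_apply, modulate_apply, smul_eq_mul]
  rw [show -(I * (x : ℂ) * ((ξ - a : ℝ) : ℂ)) = -(I * x * ξ) + I * a * x by push_cast; ring,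
    show -(I * (x : ℂ) * ((ξ + a : ℝ) : ℂ)) = -(I * x * ξ) + I * ((-a : ℝ) : ℂ) * x by
      push_cast; ring, exp_add, exp_add]
  ring

theorem FT_sqCos_eq_zero {φ : 𝓢(ℝ, ℂ)} {r : ℝ} (hφ : ∀ ξ, r ≤ |ξ| → FT φ ξ = 0)
    {a ξ : ℝ} (hξ : |ξ| ≤ a - 2 * r) : FT (sqCos φ a) ξ = 0 := by
  obtain ⟨h₁, h₂⟩ := abs_le.mp hξ
  rw [FT_sqCos, FT_mul_eq_zero hφ, FT_mul_eq_zero hφ, add_zero, zero_div]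
  · exact le_abs.mpr (Or.inl (by linarith))
  · exact le_abs.mpr (Or.inr (by linarith))

theorem hasTemperateGrowth_sqrt_one_add_sq :
    (fun w : ℝ => ((Real.sqrt (1 + (2 * Real.pi * w) ^ 2) : ℝ) : ℂ)).HasTemperateGrowth := by
  have h := (Function.hasTemperateGrowth_one_add_norm_sq_rpow ℝ (1 / 2)).comp
    ((2 * Real.pi) • ContinuousLinearMap.id ℝ ℝ).hasTemperateGrowth
  have h' := Function.HasTemperateGrowth.comp Function.Complex.hasTemperateGrowth_ofReal h
  have e : (fun w : ℝ => ((Real.sqrt (1 + (2 * Real.pi * w) ^ 2) : ℝ) : ℂ)) =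
      ofReal ∘ (fun x : ℝ => (1 + ‖x‖ ^ 2) ^ (1 / 2 : ℝ)) ∘
        ((2 * Real.pi) • ContinuousLinearMap.id ℝ ℝ) := by
    funext w
    simp [Real.sqrt_eq_rpow]
  rw [e]
  exact h'

/-- The function `w ↦ (1 + (2πw)²)^{1/2} 𝓕 f(w)`, as a Schwartz function. -/
def sqrtMulFourier (f : 𝓢(ℝ, ℂ)) : 𝓢(ℝ, ℂ) :=
  SchwartzMap.smulLeftCLM ℂ
    (fun w : ℝ => ((Real.sqrt (1 + (2 * Real.pi * w) ^ 2) : ℝ) : ℂ)) (𝓕 f)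

theorem sqrtMulFourier_apply (f : 𝓢(ℝ, ℂ)) (w : ℝ) :
    sqrtMulFourier f w =
      ((Real.sqrt (1 + (2 * Real.pi * w) ^ 2) : ℝ) : ℂ) * FT f (2 * Real.pi * w) := by
  rw [sqrtMulFourier, SchwartzMap.smulLeftCLM_apply_apply hasTemperateGrowth_sqrt_one_add_sq,
    fourier_eq_FT, smul_eq_mul]

theorem norm_sqrtMulFourier_sq (f : 𝓢(ℝ, ℂ)) (w : ℝ) :
    ‖sqrtMulFourier f w‖ ^ 2 =
      (1 + (2 * Real.pi * w) ^ 2) * ‖FT f (2 * Real.pi * w)‖ ^ 2 := by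
  rw [sqrtMulFourier_apply, norm_mul, mul_pow, norm_real, Real.norm_eq_abs, sq_abs,
    Real.sq_sqrt (by positivity)]

theorem Lam_eq_fourierInv (f : 𝓢(ℝ, ℂ)) (x : ℝ) : Lam f x = (𝓕⁻ (sqrtMulFourier f)) x := by
  have hπ : (Real.pi : ℂ) ≠ 0 := by exact_mod_cast Real.pi_ne_zero
  have h := Measure.integral_comp_mul_left
    (fun ξ : ℝ => exp (I * x * ξ) * ((Real.sqrt (1 + ξ ^ 2) : ℝ) : ℂ) * FT f ξ) (2 * Real.pi)
  rw [abs_of_pos (by positivity)] at h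
  rw [SchwartzMap.fourierInv_coe, Real.fourierInv_eq', Lam, FMul,
    show (1 / (2 * (Real.pi : ℂ))) = (((2 * Real.pi)⁻¹ : ℝ) : ℂ) by push_cast; ring,
    ← real_smul, ← h]
  congr 1
  funext w
  rw [sqrtMulFourier_apply, smul_eq_mul, mul_assoc]
  congr 2
  simp only [RCLike.inner_apply, conj_trivial]
  push_cast
  ring

theorem integral_norm_sq_eq_FT (f : 𝓢(ℝ, ℂ)) :
    ∫ x, ‖f x‖ ^ 2 = (2 * Real.pi)⁻¹ * ∫ ξ, ‖FT f ξ‖ ^ 2 := by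
  have h := Measure.integral_comp_mul_left (fun ξ : ℝ => ‖FT f ξ‖ ^ 2) (2 * Real.pi)
  rw [abs_of_pos (by positivity), smul_eq_mul] at h
  rw [← h, ← SchwartzMap.integral_norm_sq_fourier]
  simp only [fourier_eq_FT]

theorem integral_norm_Lam_sq_eq_FT (f : 𝓢(ℝ, ℂ)) :
    ∫ x, ‖Lam f x‖ ^ 2 = (2 * Real.pi)⁻¹ * ∫ ξ, (1 + ξ ^ 2) * ‖FT f ξ‖ ^ 2 := by
  have h := Measure.integral_comp_mul_left
    (fun ξ : ℝ => (1 + ξ ^ 2) * ‖FT f ξ‖ ^ 2) (2 * Real.pi)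
  rw [abs_of_pos (by positivity), smul_eq_mul] at h
  simp only [Lam_eq_fourierInv]
  rw [← h, ← SchwartzMap.integral_norm_sq_fourier, FourierTransform.fourier_fourierInv_eq]
  simp only [norm_sqrtMulFourier_sq]

theorem integrable_norm_sq (f : 𝓢(ℝ, ℂ)) : Integrable (fun x => ‖f x‖ ^ 2) :=
  (memLp_two_iff_integrable_sq_norm f.continuous.aestronglyMeasurable).mp (f.memLp 2)

theorem integrable_one_add_sq_mul_FT (f : 𝓢(ℝ, ℂ)) :
    Integrable (fun ξ : ℝ => (1 + ξ ^ 2) * ‖FT f ξ‖ ^ 2) := by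
  rw [← integrable_comp_mul_left_iff _ Real.two_pi_pos.ne']
  simpa only [norm_sqrtMulFourier_sq] using integrable_norm_sq (sqrtMulFourier f)

theorem integrable_FT_sq (f : 𝓢(ℝ, ℂ)) : Integrable (fun ξ : ℝ => ‖FT f ξ‖ ^ 2) := by
  rw [← integrable_comp_mul_left_iff _ Real.two_pi_pos.ne']
  simpa only [fourier_eq_FT] using integrable_norm_sq (𝓕 f)

theorem sq_mul_integral_FT_le {f : 𝓢(ℝ, ℂ)} {R : ℝ} (hR : 0 ≤ R)
    (hf : ∀ ξ, |ξ| ≤ R → FT f ξ = 0) :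
    R ^ 2 * ∫ ξ, ‖FT f ξ‖ ^ 2 ≤ ∫ ξ, (1 + ξ ^ 2) * ‖FT f ξ‖ ^ 2 := by
  rw [← integral_const_mul]
  refine integral_mono ((integrable_FT_sq f).const_mul _) (integrable_one_add_sq_mul_FT f)
    fun ξ => ?_
  rcases le_total |ξ| R with h | h
  · simp [hf ξ h]
  · have := sq_le_sq' (by linarith) h
    rw [sq_abs] at this
    exact mul_le_mul_of_nonneg_right (by linarith) (by positivity)

theorem mul_L2Norm_le_L2Norm_Lam {f : 𝓢(ℝ, ℂ)} {R : ℝ} (hR : 0 ≤ R)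
    (hf : ∀ ξ, |ξ| ≤ R → FT f ξ = 0) : R * L2Norm f ≤ L2Norm (Lam f) := by
  rw [L2Norm, L2Norm]
  refine Real.le_sqrt_of_sq_le ?_
  rw [mul_pow, Real.sq_sqrt (integral_nonneg fun x => by positivity), integral_norm_sq_eq_FT,
    integral_norm_Lam_sq_eq_FT, mul_left_comm]
  exact mul_le_mul_of_nonneg_left (sq_mul_integral_FT_le hR hf) (by positivity)

end

/-- Bernstein-type lower bound `‖Λg_n‖_{L²} ≥ c 2ⁿ ‖g_n‖_{L²}`, and more
precisely `∫(1+ξ²)|ĝ_n|² ≥ (λ2ⁿ-1)² ∫|ĝ_n|²`. -/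
theorem stmt9 (lam : ℝ) (hlam : lam ∈ Set.Ioo (4 / 3 : ℝ) (3 / 2))
    (φ : SchwartzMap ℝ ℂ) (hφ : PhiHyp ⇑φ) :
    ∃ c > (0 : ℝ), ∀ n : ℕ, 1 ≤ n →
      (c * (2 : ℝ) ^ n *
          L2Norm (fun x => (φ x) ^ 2 * ((Real.cos (lam * 2 ^ n * x) : ℝ) : ℂ))
        ≤ L2Norm (Lam (fun x => (φ x) ^ 2 * ((Real.cos (lam * 2 ^ n * x) : ℝ) : ℂ)))) ∧
      ((lam * 2 ^ n - 1) ^ 2 *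
          ∫ ξ : ℝ, ‖FT (fun x => (φ x) ^ 2 * ((Real.cos (lam * 2 ^ n * x) : ℝ) : ℂ)) ξ‖ ^ 2)
        ≤ ∫ ξ : ℝ, (1 + ξ ^ 2) *
            ‖FT (fun x => (φ x) ^ 2 * ((Real.cos (lam * 2 ^ n * x) : ℝ) : ℂ)) ξ‖ ^ 2 := by
  obtain ⟨ψ, hψ, -, -, -, -, hψ0⟩ := hφ
  have hsupp : ∀ ξ : ℝ, 1 / 2 ≤ |ξ| → FT φ ξ = 0 := fun ξ hξ => by rw [hψ, hψ0 ξ hξ, ofReal_zero]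
  refine ⟨1 / 2, by norm_num, fun n hn => ?_⟩
  have h2n : (2 : ℝ) ≤ 2 ^ n := by simpa using pow_le_pow_right₀ (one_le_two (α := ℝ)) hn
  have hlow : 1 / 2 * (2 : ℝ) ^ n ≤ lam * 2 ^ n - 1 := by nlinarith [hlam.1]
  have hR : 0 ≤ lam * 2 ^ n - 1 := le_trans (by positivity) hlow
  have hzero : ∀ ξ, |ξ| ≤ lam * 2 ^ n - 1 → FT (sqCos φ (lam * 2 ^ n)) ξ = 0 :=
    fun ξ hξ => FT_sqCos_eq_zero hsupp (by linarith)
  rw [show (fun x => (φ x) ^ 2 * ((Real.cos (lam * 2 ^ n * x) : ℝ) : ℂ)) =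
    sqCos φ (lam * 2 ^ n) from funext fun x => (sqCos_apply φ _ x).symm]
  exact ⟨(mul_le_mul_of_nonneg_right hlow (Real.sqrt_nonneg _)).trans
    (mul_L2Norm_le_L2Norm_Lam hR hzero), sq_mul_integral_FT_le hR hzero⟩
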